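/- Gaifman's theorem: if M ⊨ ZFC⁻ with collection and j : M → N is a Δ₀-elementary cofinal embedding of ∈-structures, then j is fully elementary. -/

import Mathlib

universe u

/-- First-order formulas of set theory with `n` free variables (de Bruijn style),
with primitive bounded quantifiers. -/
inductive Fml : ℕ → Type
  | mem {n} (i j : Fin n) : Fml n
  | eq {n} (i j : Fin n) : Fml n
  | not {n} : Fml n → Fml n
  | and {n} : Fml n → Fml n → Fml n
  | ball {n} (i : Fin n) : Fml (n + 1) → Fml n
  | bex {n} (i : Fin n) : Fml (n + 1) → Fml n
  | all {n} : Fml (n + 1) → Fml n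
  | ex {n} : Fml (n + 1) → Fml n

/-- Δ₀ formulas: only bounded quantifiers. -/
inductive IsDelta0 : ∀ {n}, Fml n → Prop
  | mem {n} (i j : Fin n) : IsDelta0 (Fml.mem i j)
  | eq {n} (i j : Fin n) : IsDelta0 (Fml.eq i j)
  | not {n} {φ : Fml n} : IsDelta0 φ → IsDelta0 φ.not
  | and {n} {φ ψ : Fml n} : IsDelta0 φ → IsDelta0 ψ → IsDelta0 (φ.and ψ)
  | ball {n} (i : Fin n) {φ : Fml (n + 1)} : IsDelta0 φ → IsDelta0 (Fml.ball i φ)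
  | bex {n} (i : Fin n) {φ : Fml (n + 1)} : IsDelta0 φ → IsDelta0 (Fml.bex i φ)

/-- Σ₁ formulas: an unbounded existential quantifier applied to a Δ₀ formula. -/
def IsSigma1 {n} (φ : Fml n) : Prop := ∃ ψ : Fml (n + 1), IsDelta0 ψ ∧ φ = Fml.ex ψ

/-- Π₁ formulas: an unbounded universal quantifier applied to a Δ₀ formula. -/
def IsPi1 {n} (φ : Fml n) : Prop := ∃ ψ : Fml (n + 1), IsDelta0 ψ ∧ φ = Fml.all ψ

/-- Satisfaction in an abstract ∈-structure `(α, E)`. -/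
def Sat {α : Type u} (E : α → α → Prop) : ∀ {n}, Fml n → (Fin n → α) → Prop
  | _, .mem i j, v => E (v i) (v j)
  | _, .eq i j, v => v i = v j
  | _, .not φ, v => ¬ Sat E φ v
  | _, .and φ ψ, v => Sat E φ v ∧ Sat E ψ v
  | _, .ball i φ, v => ∀ a, E a (v i) → Sat E φ (Fin.snoc v a)
  | _, .bex i φ, v => ∃ a, E a (v i) ∧ Sat E φ (Fin.snoc v a)
  | _, .all φ, v => ∀ a, Sat E φ (Fin.snoc v a)
  | _, .ex φ, v => ∃ a, Sat E φ (Fin.snoc v a)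

/-- Satisfaction in a structure with a (possibly non-trivial) equality interpretation,
as used for (pre-quotient) ultrapowers. -/
def Sat2 {α : Type u} (Eq' E : α → α → Prop) : ∀ {n}, Fml n → (Fin n → α) → Prop
  | _, .mem i j, v => E (v i) (v j)
  | _, .eq i j, v => Eq' (v i) (v j)
  | _, .not φ, v => ¬ Sat2 Eq' E φ v
  | _, .and φ ψ, v => Sat2 Eq' E φ v ∧ Sat2 Eq' E ψ v
  | _, .ball i φ, v => ∀ a, E a (v i) → Sat2 Eq' E φ (Fin.snoc v a)
  | _, .bex i φ, v => ∃ a, E a (v i) ∧ Sat2 Eq' E φ (Fin.snoc v a)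
  | _, .all φ, v => ∀ a, Sat2 Eq' E φ (Fin.snoc v a)
  | _, .ex φ, v => ∃ a, Sat2 Eq' E φ (Fin.snoc v a)

/-- Satisfaction in a class `M` of ZF-sets, with quantifiers relativized to `M`. -/
def SatC (M : Set ZFSet.{u}) : ∀ {n}, Fml n → (Fin n → ZFSet.{u}) → Prop
  | _, .mem i j, v => v i ∈ v j
  | _, .eq i j, v => v i = v j
  | _, .not φ, v => ¬ SatC M φ v
  | _, .and φ ψ, v => SatC M φ v ∧ SatC M ψ v
  | _, .ball i φ, v => ∀ a ∈ M, a ∈ v i → SatC M φ (Fin.snoc v a)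
  | _, .bex i φ, v => ∃ a ∈ M, a ∈ v i ∧ SatC M φ (Fin.snoc v a)
  | _, .all φ, v => ∀ a ∈ M, SatC M φ (Fin.snoc v a)
  | _, .ex φ, v => ∃ a ∈ M, SatC M φ (Fin.snoc v a)

/-- A class of ZF-sets is transitive. -/
def TransCls (M : Set ZFSet.{u}) : Prop := ∀ x ∈ M, ∀ y : ZFSet, y ∈ x → y ∈ M

/- Semantic versions of the axioms of set theory for a class `M` of ZF-sets. -/

def AxExt (M : Set ZFSet.{u}) : Prop :=
  ∀ x ∈ M, ∀ y ∈ M, (∀ z : ZFSet, z ∈ x ↔ z ∈ y) → x = y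

def AxFound (M : Set ZFSet.{u}) : Prop :=
  ∀ x ∈ M, x ≠ ∅ → ∃ y : ZFSet, y ∈ x ∧ ∀ z : ZFSet, z ∈ x → z ∉ y

def AxPair (M : Set ZFSet.{u}) : Prop := ∀ x ∈ M, ∀ y ∈ M, ({x, y} : ZFSet) ∈ M

def AxUnion (M : Set ZFSet.{u}) : Prop := ∀ x ∈ M, ZFSet.sUnion x ∈ M

def AxInf (M : Set ZFSet.{u}) : Prop := ZFSet.omega ∈ M

def AxPow (M : Set ZFSet.{u}) : Prop := ∀ x ∈ M, ZFSet.powerset x ∈ M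

def AxSep (M : Set ZFSet.{u}) : Prop :=
  ∀ (n : ℕ) (φ : Fml (n + 1)) (v : Fin n → ZFSet), (∀ i, v i ∈ M) →
    ∀ x ∈ M, ZFSet.sep (fun y => SatC M φ (Fin.snoc v y)) x ∈ M

def AxRepl (M : Set ZFSet.{u}) : Prop :=
  ∀ (n : ℕ) (φ : Fml (n + 2)) (v : Fin n → ZFSet), (∀ i, v i ∈ M) →
    ∀ A ∈ M,
      (∀ a : ZFSet, a ∈ A →
        ∃! b : ZFSet, b ∈ M ∧ SatC M φ (Fin.snoc (Fin.snoc v a) b)) →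
      ∃ B ∈ M, ∀ b : ZFSet,
        b ∈ B ↔ ∃ a : ZFSet, a ∈ A ∧ SatC M φ (Fin.snoc (Fin.snoc v a) b)

def AxColl (M : Set ZFSet.{u}) : Prop :=
  ∀ (n : ℕ) (φ : Fml (n + 2)) (v : Fin n → ZFSet), (∀ i, v i ∈ M) →
    ∀ A ∈ M,
      (∀ a : ZFSet, a ∈ A → ∃ b ∈ M, SatC M φ (Fin.snoc (Fin.snoc v a) b)) →
      ∃ B ∈ M, ∀ a : ZFSet, a ∈ A →
        ∃ b : ZFSet, b ∈ B ∧ SatC M φ (Fin.snoc (Fin.snoc v a) b)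

/-- The well-ordering principle: every set carries a well-order (in `M`). -/
def AxWO (M : Set ZFSet.{u}) : Prop :=
  ∀ x ∈ M, ∃ r ∈ M,
    (∀ p ∈ r, ∃ a, a ∈ x ∧ ∃ b, b ∈ x ∧ p = ZFSet.pair a b) ∧
    IsWellOrder x.toSet.Elem (fun a b => ZFSet.pair a.1 b.1 ∈ r)

/-- ZFC minus power set, with replacement (the theory called `ZFC-` in the paper). -/
def ZFCminusRepl (M : Set ZFSet.{u}) : Prop :=
  AxExt M ∧ AxFound M ∧ AxPair M ∧ AxUnion M ∧ AxInf M ∧ AxSep M ∧ AxRepl M ∧ AxWO M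

/-- ZFC minus power set, with collection (the theory called `ZFC⁻` in the paper). -/
def ZFCminusColl (M : Set ZFSet.{u}) : Prop := ZFCminusRepl M ∧ AxColl M

/-- The (semantic) ZFC axioms for a transitive class. -/
def ZFCax (M : Set ZFSet.{u}) : Prop := ZFCminusRepl M ∧ AxPow M

/-- `f` is (coded as) a set-function with domain `d`. -/
def IsFnOn (d f : ZFSet.{u}) : Prop :=
  (∀ p ∈ f, ∃ a, a ∈ d ∧ ∃ b : ZFSet, p = ZFSet.pair a b) ∧
  ∀ a, a ∈ d → ∃! b : ZFSet, ZFSet.pair a b ∈ f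

/-- Application of a set-coded function. -/
noncomputable def app (f a : ZFSet.{u}) : ZFSet.{u} :=
  Classical.epsilon fun b => ZFSet.pair a b ∈ f

/-- The class of sets of hereditary size less than `κ`. -/
def Hclass (κ : Cardinal.{u + 1}) : Set ZFSet.{u} :=
  {x | ∃ t : ZFSet, t.IsTransitive ∧ x ⊆ t ∧ Cardinal.mk t.toSet < κ}

section AbstractStructure
variable {α : Type u}

/-- `p` codes the (Kuratowski) ordered pair `(x, y)` in the ∈-structure `(α, E)`. -/
def IsOPair (E : α → α → Prop) (p x y : α) : Prop :=
  ∀ z, E z p ↔ (∀ w, E w z ↔ w = x) ∨ (∀ w, E w z ↔ (w = x ∨ w = y))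

/-- Pairing axiom in an abstract ∈-structure. -/
def APair (E : α → α → Prop) : Prop :=
  ∀ x y : α, ∃ p : α, ∀ z : α, E z p ↔ (z = x ∨ z = y)

/-- Union axiom in an abstract ∈-structure. -/
def AUnion (E : α → α → Prop) : Prop :=
  ∀ x : α, ∃ u : α, ∀ z : α, E z u ↔ ∃ w : α, E w x ∧ E z w

/-- Infinity axiom in an abstract ∈-structure. -/
def AInf (E : α → α → Prop) : Prop :=
  ∃ I : α, (∃ e, E e I ∧ ∀ z, ¬E z e) ∧
    ∀ x, E x I → ∃ s, E s I ∧ ∀ z, E z s ↔ (E z x ∨ z = x)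

/-- Separation scheme in an abstract ∈-structure. -/
def ASep (E : α → α → Prop) : Prop :=
  ∀ (n : ℕ) (φ : Fml (n + 1)) (v : Fin n → α) (x : α),
    ∃ s : α, ∀ z : α, E z s ↔ (E z x ∧ Sat E φ (Fin.snoc v z))

/-- Collection scheme in an abstract ∈-structure. -/
def ACollA (E : α → α → Prop) : Prop :=
  ∀ (n : ℕ) (φ : Fml (n + 2)) (v : Fin n → α) (A : α),
    (∀ a, E a A → ∃ b, Sat E φ (Fin.snoc (Fin.snoc v a) b)) →
    ∃ B, ∀ a, E a A → ∃ b, E b B ∧ Sat E φ (Fin.snoc (Fin.snoc v a) b)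

/-- Existence of cartesian products in an abstract ∈-structure. -/
def AProd (E : α → α → Prop) : Prop :=
  ∀ a b : α, ∃ c : α, ∀ x y : α, E x a → E y b → ∃ p, E p c ∧ IsOPair E p x y

end AbstractStructure

namespace Fml

/-- Disjunction of two formulas. -/
def or {n} (φ ψ : Fml n) : Fml n := .not (.and φ.not ψ.not)

/-- Implication between two formulas. -/
def imp {n} (φ ψ : Fml n) : Fml n := .or φ.not ψ

/-- Renaming of the free variables of a formula. -/
def rename : ∀ {n m}, (Fin n → Fin m) → Fml n → Fml m
  | _, _, f, .mem i j => .mem (f i) (f j)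
  | _, _, f, .eq i j => .eq (f i) (f j)
  | _, _, f, .not φ => .not (rename f φ)
  | _, _, f, .and φ ψ => .and (rename f φ) (rename f ψ)
  | _, m, f, .ball i φ => .ball (f i) (rename (Fin.snoc (fun k => (f k).castSucc) (Fin.last m)) φ)
  | _, m, f, .bex i φ => .bex (f i) (rename (Fin.snoc (fun k => (f k).castSucc) (Fin.last m)) φ)
  | _, m, f, .all φ => .all (rename (Fin.snoc (fun k => (f k).castSucc) (Fin.last m)) φ)
  | _, m, f, .ex φ => .ex (rename (Fin.snoc (fun k => (f k).castSucc) (Fin.last m)) φ)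

/-- Existential quantification over the last `k` variables. -/
def exs : ∀ (k : ℕ) {n : ℕ}, Fml (n + k) → Fml n
  | 0, _, φ => φ
  | k + 1, _, φ => exs k (.ex φ)

/-- Universal quantification of the last `k` variables over the elements of the `i`-th one. -/
def balls : ∀ (k : ℕ) {n : ℕ}, Fin n → Fml (n + k) → Fml n
  | 0, _, _, φ => φ
  | k + 1, _, i, φ => balls k i (.ball (Fin.castAdd k i) φ)

/-- The formula `z = {x, y}`. -/
def upair {n} (z x y : Fin n) : Fml n :=
  .and (.mem x z) (.and (.mem y z)
    (.ball z (.or (.eq (Fin.last n) x.castSucc) (.eq (Fin.last n) y.castSucc))))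

/-- The Δ₀ formula `p = (x, y)`. -/
def opair {n} (p x y : Fin n) : Fml n :=
  .and (.ball p (.or (upair (Fin.last n) x.castSucc x.castSucc)
      (upair (Fin.last n) x.castSucc y.castSucc)))
    (.and (.bex p (upair (Fin.last n) x.castSucc x.castSucc))
      (.bex p (upair (Fin.last n) x.castSucc y.castSucc)))

/-- The Δ₀ formula saying that `p` codes the tuple `x`. -/
def tuple : ∀ (k : ℕ) {n : ℕ}, Fin n → (Fin k → Fin n) → Fml n
  | 0, _, p, _ => .eq p p
  | k + 1, n, p, x =>
    .bex p (.bex (Fin.last n) (.and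
      (opair p.castSucc.castSucc (Fin.last (n + 1)) (x (Fin.last k)).castSucc.castSucc)
      (tuple k (Fin.last (n + 1)) fun i => (x i.castSucc).castSucc.castSucc)))

/-- The Δ₀ formula saying that some element of `s` codes the tuple `x`. -/
def rel (k : ℕ) {n : ℕ} (s : Fin n) (x : Fin k → Fin n) : Fml n :=
  .bex s (tuple k (Fin.last n) fun i => (x i).castSucc)

end Fml

section Delta0

theorem IsDelta0.or {n} {φ ψ : Fml n} (hφ : IsDelta0 φ) (hψ : IsDelta0 ψ) :
    IsDelta0 (φ.or ψ) :=
  .not (.and hφ.not hψ.not)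

theorem IsDelta0.imp {n} {φ ψ : Fml n} (hφ : IsDelta0 φ) (hψ : IsDelta0 ψ) :
    IsDelta0 (φ.imp ψ) :=
  hφ.not.or hψ

theorem IsDelta0.rename {n m} {φ : Fml n} (hφ : IsDelta0 φ) (f : Fin n → Fin m) :
    IsDelta0 (φ.rename f) := by
  induction hφ generalizing m with
  | mem => exact .mem _ _
  | eq => exact .eq _ _
  | not _ ih => exact .not (ih f)
  | and _ _ ih₁ ih₂ => exact .and (ih₁ f) (ih₂ f)
  | ball _ _ ih => exact .ball _ (ih _)
  | bex _ _ ih => exact .bex _ (ih _)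

theorem IsDelta0.balls (k : ℕ) {n : ℕ} (i : Fin n) {φ : Fml (n + k)} (hφ : IsDelta0 φ) :
    IsDelta0 (φ.balls k i) := by
  induction k with
  | zero => exact hφ
  | succ k ih => exact ih (.ball _ hφ)

theorem isDelta0_upair {n} (z x y : Fin n) : IsDelta0 (Fml.upair z x y) :=
  .and (.mem _ _) (.and (.mem _ _) (.ball _ (.or (.eq _ _) (.eq _ _))))

theorem isDelta0_opair {n} (p x y : Fin n) : IsDelta0 (Fml.opair p x y) :=
  .and (.ball _ (.or (isDelta0_upair _ _ _) (isDelta0_upair _ _ _)))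
    (.and (.bex _ (isDelta0_upair _ _ _)) (.bex _ (isDelta0_upair _ _ _)))

theorem isDelta0_tuple (k : ℕ) {n : ℕ} (p : Fin n) (x : Fin k → Fin n) :
    IsDelta0 (Fml.tuple k p x) := by
  induction k generalizing n with
  | zero => exact .eq _ _
  | succ k ih => exact .bex _ (.bex _ (.and (isDelta0_opair _ _ _) (ih _ _)))

theorem isDelta0_rel (k : ℕ) {n : ℕ} (s : Fin n) (x : Fin k → Fin n) :
    IsDelta0 (Fml.rel k s x) :=
  .bex _ (isDelta0_tuple _ _ _)

end Delta0

section Semantics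

variable {α : Type u}

/-- `z` has exactly the elements `x` and `y`. -/
def IsUPair (E : α → α → Prop) (z x y : α) : Prop :=
  E x z ∧ E y z ∧ ∀ w, E w z → w = x ∨ w = y

/-- A Δ₀ version of `IsOPair`: every element of `p` is a copy of `{x}` or of `{x, y}`, and a copy
of each of them occurs. It still determines `x` and `y` in the absence of extensionality. -/
def IsWeakOPair (E : α → α → Prop) (p x y : α) : Prop :=
  (∀ z, E z p → IsUPair E z x x ∨ IsUPair E z x y) ∧
    (∃ z, E z p ∧ IsUPair E z x x) ∧ ∃ z, E z p ∧ IsUPair E z x y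

/-- `p` codes the tuple `x` by iterated ordered pairs. -/
def IsTuple (E : α → α → Prop) : ∀ k : ℕ, α → (Fin k → α) → Prop
  | 0, _, _ => True
  | k + 1, p, x => ∃ z, E z p ∧ ∃ q, E q z ∧
      IsWeakOPair E p q (x (Fin.last k)) ∧ IsTuple E k q fun i => x i.castSucc

/-- Some element of `s` codes the tuple `x`. -/
def TupleMem (E : α → α → Prop) (k : ℕ) (s : α) (x : Fin k → α) : Prop :=
  ∃ p, E p s ∧ IsTuple E k p x

variable {E : α → α → Prop}

theorem sat_or {n} (φ ψ : Fml n) (v : Fin n → α) :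
    Sat E (φ.or ψ) v ↔ Sat E φ v ∨ Sat E ψ v := by
  simp only [Fml.or, Sat]
  tauto

theorem sat_imp {n} (φ ψ : Fml n) (v : Fin n → α) :
    Sat E (φ.imp ψ) v ↔ (Sat E φ v → Sat E ψ v) := by
  simp only [Fml.imp, sat_or, Sat]
  tauto

theorem sat_rename {n m} (f : Fin n → Fin m) (φ : Fml n) (v : Fin m → α) :
    Sat E (φ.rename f) v ↔ Sat E φ fun i => v (f i) := by
  have key : ∀ {n m} (f : Fin n → Fin m) (v : Fin m → α) (a : α),
      (fun i => (Fin.snoc v a : Fin (m + 1) → α)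
        ((Fin.snoc (fun k => (f k).castSucc) (Fin.last m) : Fin (n + 1) → Fin (m + 1)) i)) =
      Fin.snoc (fun i => v (f i)) a := by
    intro n m f v a
    funext i
    refine Fin.lastCases ?_ (fun i => ?_) i <;> simp
  induction φ generalizing m with
  | mem | eq => rfl
  | not φ ih => simp only [Fml.rename, Sat, ih]
  | and φ ψ ih₁ ih₂ => simp only [Fml.rename, Sat, ih₁, ih₂]
  | ball i φ ih | bex i φ ih | all φ ih | ex φ ih => simp only [Fml.rename, Sat, ih, key]

theorem sat_exs (k : ℕ) {n : ℕ} (φ : Fml (n + k)) (v : Fin n → α) :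
    Sat E (φ.exs k) v ↔ ∃ x : Fin k → α, Sat E φ (Fin.append v x) := by
  induction k with
  | zero => simp [Fml.exs, Fin.append_right_nil]
  | succ k ih =>
    simp only [Fml.exs, ih, Sat, ← Fin.append_snoc]
    exact ⟨fun ⟨x, a, h⟩ => ⟨_, h⟩,
      fun ⟨x, h⟩ => ⟨Fin.init x, x (Fin.last k), by rwa [Fin.snoc_init_self]⟩⟩

theorem sat_balls (k : ℕ) {n : ℕ} (i : Fin n) (φ : Fml (n + k)) (v : Fin n → α) :
    Sat E (φ.balls k i) v ↔
      ∀ x : Fin k → α, (∀ m, E (x m) (v i)) → Sat E φ (Fin.append v x) := by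
  induction k with
  | zero => simp [Fml.balls, Fin.append_right_nil]
  | succ k ih =>
    simp only [Fml.balls, ih, Sat, ← Fin.append_snoc, Fin.append_left]
    refine ⟨fun h x hx => ?_, fun h x hx a ha => h _ (Fin.lastCases ?_ fun m => ?_)⟩
    · rw [← Fin.snoc_init_self x]
      exact h _ (fun m => hx m.castSucc) _ (hx _)
    · simpa using ha
    · simpa using hx m

theorem sat_upair {n} (z x y : Fin n) (v : Fin n → α) :
    Sat E (Fml.upair z x y) v ↔ IsUPair E (v z) (v x) (v y) := by
  simp [Fml.upair, IsUPair, Sat, sat_or]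

theorem sat_opair {n} (p x y : Fin n) (v : Fin n → α) :
    Sat E (Fml.opair p x y) v ↔ IsWeakOPair E (v p) (v x) (v y) := by
  simp [Fml.opair, IsWeakOPair, Sat, sat_or, sat_upair]

theorem sat_tuple (k : ℕ) {n : ℕ} (p : Fin n) (x : Fin k → Fin n) (v : Fin n → α) :
    Sat E (Fml.tuple k p x) v ↔ IsTuple E k (v p) fun i => v (x i) := by
  induction k generalizing n with
  | zero => simp [Fml.tuple, IsTuple, Sat]
  | succ k ih => simp [Fml.tuple, IsTuple, Sat, ih, sat_opair]

theorem sat_rel (k : ℕ) {n : ℕ} (s : Fin n) (x : Fin k → Fin n) (v : Fin n → α) :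
    Sat E (Fml.rel k s x) v ↔ TupleMem E k (v s) fun i => v (x i) := by
  simp [Fml.rel, TupleMem, Sat, sat_tuple]

theorem IsWeakOPair.inj {p x y x' y' : α} (h : IsWeakOPair E p x y)
    (h' : IsWeakOPair E p x' y') : x = x' ∧ y = y' := by
  unfold IsWeakOPair IsUPair at *
  grind

theorem IsTuple.inj {k : ℕ} {p : α} {x y : Fin k → α} (hx : IsTuple E k p x)
    (hy : IsTuple E k p y) : x = y := by
  induction k generalizing p with
  | zero => exact Subsingleton.elim _ _
  | succ k ih =>
    obtain ⟨_, _, q, _, hq, hqx⟩ := hx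
    obtain ⟨_, _, r, _, hr, hry⟩ := hy
    obtain ⟨rfl, hl⟩ := hq.inj hr
    have := ih hqx hry
    funext i
    exact Fin.lastCases hl (fun i => congrFun this i) i

theorem IsOPair.isWeakOPair (hpair : APair E) {p x y : α} (h : IsOPair E p x y) :
    IsWeakOPair E p x y := by
  have key : ∀ z x y : α, (∀ w, E w z ↔ (w = x ∨ w = y)) → IsUPair E z x y :=
    fun z x y hz => ⟨(hz x).2 (.inl rfl), (hz y).2 (.inr rfl), fun w => (hz w).1⟩
  refine ⟨fun z hz => ((h z).1 hz).imp (fun H => key _ _ _ (by simpa using H)) (key _ _ _), ?_, ?_⟩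
  · obtain ⟨z, hz⟩ := hpair x x
    exact ⟨z, (h z).2 (.inl (by simpa using hz)), key _ _ _ hz⟩
  · obtain ⟨z, hz⟩ := hpair x y
    exact ⟨z, (h z).2 (.inr hz), key _ _ _ hz⟩

theorem exists_superset_union (hpair : APair E) (hunion : AUnion E) (a b : α) :
    ∃ d, (∀ z, E z a → E z d) ∧ ∀ z, E z b → E z d := by
  obtain ⟨p, hp⟩ := hpair a b
  obtain ⟨d, hd⟩ := hunion p
  exact ⟨d, fun z hz => (hd z).2 ⟨a, (hp a).2 (.inl rfl), hz⟩,
    fun z hz => (hd z).2 ⟨b, (hp b).2 (.inr rfl), hz⟩⟩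

theorem exists_forall_mem [Nonempty α] (hpair : APair E) (hunion : AUnion E) {n : ℕ}
    (v : Fin n → α) : ∃ a, ∀ i, E (v i) a := by
  induction n with
  | zero => exact ⟨Classical.arbitrary α, fun i => i.elim0⟩
  | succ n ih =>
    obtain ⟨a, ha⟩ := ih fun i => v i.castSucc
    obtain ⟨b, hb⟩ := hpair (v (Fin.last n)) (v (Fin.last n))
    obtain ⟨d, had, hbd⟩ := exists_superset_union hpair hunion a b
    exact ⟨d, Fin.lastCases (hbd _ ((hb _).2 (.inl rfl))) fun i => had _ (ha i)⟩

/-- All `k`-tuples from `a` have codes in a single set. -/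
theorem exists_tupleMem (hpair : APair E) (hprod : AProd E) (k : ℕ) (a : α) :
    ∃ c, ∀ x : Fin k → α, (∀ i, E (x i) a) → TupleMem E k c x := by
  induction k with
  | zero =>
    obtain ⟨c, hc⟩ := hpair a a
    exact ⟨c, fun _ _ => ⟨a, (hc a).2 (.inl rfl), trivial⟩⟩
  | succ k ih =>
    obtain ⟨c, hc⟩ := ih
    obtain ⟨d, hd⟩ := hprod c a
    refine ⟨d, fun x hx => ?_⟩
    obtain ⟨q, hqc, hq⟩ := hc (fun i => x i.castSucc) fun i => hx _
    obtain ⟨p, hpd, hp⟩ := hd q _ hqc (hx (Fin.last k))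
    have hp := hp.isWeakOPair hpair
    obtain ⟨z, hzp, hz⟩ := hp.2.1
    exact ⟨p, hpd, z, hzp, q, hz.1, hp, hq⟩

/-- The trace of a formula on the tuples from a set is coded by a set. -/
theorem exists_code (hpair : APair E) (hsep : ASep E) (hprod : AProd E) {k : ℕ} (φ : Fml k)
    (a : α) :
    ∃ s, ∀ x : Fin k → α, (∀ i, E (x i) a) → (TupleMem E k s x ↔ Sat E φ x) := by
  obtain ⟨c, hc⟩ := exists_tupleMem hpair hprod k a
  obtain ⟨s, hs⟩ := hsep 0 (Fml.exs k (.and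
    (.tuple k (Fin.castAdd k 0) (Fin.natAdd (0 + 1))) (φ.rename (Fin.natAdd (0 + 1))))) Fin.elim0 c
  simp only [sat_exs, Sat, sat_tuple, sat_rename, Fin.append_left, Fin.append_right] at hs
  refine ⟨s, fun x hx => ⟨?_, fun h => ?_⟩⟩
  · rintro ⟨p, hps, hp⟩
    obtain ⟨-, y, hy, hφ⟩ := (hs p).1 hps
    exact hp.inj hy ▸ hφ
  · obtain ⟨p, hpc, hp⟩ := hc x hx
    exact ⟨p, (hs p).2 ⟨hpc, x, hp, h⟩, hp⟩

/-- Collection for tuples of elements of a set. -/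
theorem exists_bound (hpair : APair E) (hsep : ASep E) (hcoll : ACollA E) (hprod : AProd E)
    {k : ℕ} (φ : Fml (k + 1)) (a : α) :
    ∃ b, ∀ x : Fin k → α, (∀ i, E (x i) a) → (∃ z, Sat E φ (Fin.snoc x z)) →
      ∃ z, E z b ∧ Sat E φ (Fin.snoc x z) := by
  obtain ⟨c, hc⟩ := exists_tupleMem hpair hprod k a
  obtain ⟨s, hs⟩ := hsep 0 (Fml.exs k (.and
    (.tuple k (Fin.castAdd k 0) (Fin.natAdd (0 + 1)))
    (φ.ex.rename (Fin.natAdd (0 + 1))))) Fin.elim0 c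
  simp only [sat_exs, Sat, sat_tuple, sat_rename, Fin.append_left, Fin.append_right] at hs
  have key : ∀ p z : α, Sat E (Fml.exs k (.and
      (.tuple k (Fin.castAdd k 0) (Fin.natAdd (0 + 2)))
      (φ.rename (Fin.snoc (Fin.natAdd (0 + 2)) (Fin.castAdd k 1)))))
      (Fin.snoc (Fin.snoc Fin.elim0 p) z) ↔
      ∃ x : Fin k → α, IsTuple E k p x ∧ Sat E φ (Fin.snoc x z) := by
    intro p z
    simp only [sat_exs, Sat, sat_tuple, sat_rename, Fin.append_left, Fin.append_right]
    refine exists_congr fun x => and_congr Iff.rfl (iff_of_eq (congrArg _ ?_))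
    funext i
    refine Fin.lastCases ?_ (fun i => ?_) i
    · simp only [Fin.snoc_last, Fin.append_left]
      rfl
    · simp only [Fin.snoc_castSucc, Fin.append_right]
  obtain ⟨b, hb⟩ := hcoll 0 _ Fin.elim0 s fun p hp => by
    obtain ⟨-, x, hx, z, hz⟩ := (hs p).1 hp
    exact ⟨z, (key p z).2 ⟨x, hx, hz⟩⟩
  refine ⟨b, fun x hx h => ?_⟩
  obtain ⟨p, hpc, hp⟩ := hc x hx
  obtain ⟨z, hzb, hz⟩ := hb p ((hs p).2 ⟨hpc, x, hp, h⟩)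
  obtain ⟨y, hy, hφ⟩ := (key p z).1 hz
  exact ⟨z, hzb, hp.inj hy ▸ hφ⟩

end Semantics

section Elementarity

variable {α β : Type u}

/-- `j` preserves and reflects Δ₀ formulas. -/
def Delta0Elementary (E : α → α → Prop) (E' : β → β → Prop) (j : α → β) : Prop :=
  ∀ {n : ℕ} (φ : Fml n), IsDelta0 φ → ∀ v : Fin n → α,
    (Sat E φ v ↔ Sat E' φ fun i => j (v i))

/-- Whenever `s` codes the trace of `φ` on `a`, its image codes the trace of `φ` on the image
of `a`. -/
def PreservesCodes (E : α → α → Prop) (E' : β → β → Prop) (j : α → β) {k : ℕ}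
    (φ : Fml k) : Prop :=
  ∀ a s, (∀ x : Fin k → α, (∀ i, E (x i) a) → (TupleMem E k s x ↔ Sat E φ x)) →
    ∀ y : Fin k → β, (∀ i, E' (y i) (j a)) → (TupleMem E' k (j s) y ↔ Sat E' φ y)

variable {E : α → α → Prop} {E' : β → β → Prop} {j : α → β}

theorem PreservesCodes.congr {k : ℕ} {φ ψ : Fml k} (h : PreservesCodes E E' j φ)
    (hE : ∀ v, Sat E φ v ↔ Sat E ψ v) (hE' : ∀ v, Sat E' φ v ↔ Sat E' ψ v) :
    PreservesCodes E E' j ψ := by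
  intro a s hs y hy
  rw [h a s (fun x hx => (hs x hx).trans (hE x).symm) y hy, hE']

namespace Delta0Elementary


/-- Bounded universal statements about tuples transfer along `j`. -/
theorem forall_tuple (hj : Delta0Elementary E E' j) {n k : ℕ} (i : Fin n)
    {φ : Fml (n + k)} (hφ : IsDelta0 φ) (v : Fin n → α)
    (h : ∀ x : Fin k → α, (∀ m, E (x m) (v i)) → Sat E φ (Fin.append v x))
    (y : Fin k → β) (hy : ∀ m, E' (y m) (j (v i))) :
    Sat E' φ (Fin.append (fun i => j (v i)) y) :=
  (sat_balls k i φ _).1 ((hj _ (hφ.balls k i) v).1 ((sat_balls k i φ v).2 h)) y hy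

theorem mem (hj : Delta0Elementary E E' j) {x a : α} (h : E x a) : E' (j x) (j a) :=
  (hj (n := 2) (.mem 0 1) (.mem _ _) ![x, a]).1 h

theorem subset (hj : Delta0Elementary E E' j) {a b : α} (h : ∀ z, E z a → E z b)
    (w : β) (hw : E' w (j a)) : E' w (j b) := by
  have := (hj (n := 2) (.ball 0 (.mem (Fin.last 2) (Fin.castSucc 1)))
    (.ball _ (.mem _ _)) ![a, b]).1
  simp only [Sat, Fin.snoc_last, Fin.snoc_castSucc] at this
  exact this h w hw

theorem tupleMem_iff (hj : Delta0Elementary E E' j) {k : ℕ} (s : α) (x : Fin k → α) :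
    TupleMem E k s x ↔ TupleMem E' k (j s) fun i => j (x i) := by
  have := hj _ (isDelta0_rel k (Fin.castAdd k 0) (Fin.natAdd 1)) (Fin.append ![s] x)
  simpa only [sat_rel, Fin.append_left, Fin.append_right, Matrix.cons_val_fin_one] using this

theorem preservesCodes_of_isDelta0 (hj : Delta0Elementary E E' j) {k : ℕ} {φ : Fml k}
    (hφ : IsDelta0 φ) : PreservesCodes E E' j φ := by
  intro a s hs y hy
  have hrel := isDelta0_rel k (Fin.castAdd k (1 : Fin 2)) (Fin.natAdd 2)
  have h := hj.forall_tuple 0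
    (.and (hrel.imp (hφ.rename (Fin.natAdd 2))) ((hφ.rename (Fin.natAdd 2)).imp hrel)) ![a, s]
  simp only [Sat, sat_imp, sat_rel, sat_rename, Fin.append_left, Fin.append_right,
    Matrix.cons_val_zero, Matrix.cons_val_one, ← iff_iff_implies_and_implies] at h
  exact h hs y hy

theorem preservesCodes_not (hj : Delta0Elementary E E' j) (hpair : APair E) (hsep : ASep E)
    (hprod : AProd E) {k : ℕ} {φ : Fml k} (hφ : PreservesCodes E E' j φ) :
    PreservesCodes E E' j φ.not := by
  intro a s hs y hy
  obtain ⟨t, ht⟩ := exists_code hpair hsep hprod φ a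
  have hrel := fun i : Fin 3 => isDelta0_rel k (Fin.castAdd k i) (Fin.natAdd 3)
  have h := hj.forall_tuple 0
    (.and ((hrel 1).imp (hrel 2).not) ((hrel 2).not.imp (hrel 1))) ![a, s, t]
  simp only [Sat, sat_imp, sat_rel, Fin.append_left, Fin.append_right,
    Matrix.cons_val_zero, Matrix.cons_val_one, Matrix.cons_val,
    ← iff_iff_implies_and_implies] at h
  rw [h (fun x hx => (hs x hx).trans (not_congr (ht x hx).symm)) y hy, hφ a t ht y hy]
  rfl

theorem preservesCodes_and (hj : Delta0Elementary E E' j) (hpair : APair E) (hsep : ASep E)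
    (hprod : AProd E) {k : ℕ} {φ ψ : Fml k} (hφ : PreservesCodes E E' j φ)
    (hψ : PreservesCodes E E' j ψ) : PreservesCodes E E' j (φ.and ψ) := by
  intro a s hs y hy
  obtain ⟨t, ht⟩ := exists_code hpair hsep hprod φ a
  obtain ⟨r, hr⟩ := exists_code hpair hsep hprod ψ a
  have hrel := fun i : Fin 4 => isDelta0_rel k (Fin.castAdd k i) (Fin.natAdd 4)
  have h := hj.forall_tuple 0
    (.and ((hrel 1).imp ((hrel 2).and (hrel 3))) (((hrel 2).and (hrel 3)).imp (hrel 1)))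
    ![a, s, t, r]
  simp only [Sat, sat_imp, sat_rel, Fin.append_left, Fin.append_right,
    Matrix.cons_val_zero, Matrix.cons_val_one, Matrix.cons_val,
    ← iff_iff_implies_and_implies] at h
  rw [h (fun x hx => (hs x hx).trans (and_congr (ht x hx).symm (hr x hx).symm)) y hy,
    hφ a t ht y hy, hψ a r hr y hy]
  rfl

theorem preservesCodes_ex (hj : Delta0Elementary E E' j) (hpair : APair E) (hunion : AUnion E)
    (hsep : ASep E) (hcoll : ACollA E) (hprod : AProd E) (hcof : ∀ y : β, ∃ a : α, E' y (j a))
    {k : ℕ} {φ : Fml (k + 1)} (hφ : PreservesCodes E E' j φ) : PreservesCodes E E' j φ.ex := by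
  intro a s hs y hy
  have hsnoc : ∀ {γ : Type u} (w : Fin (4 + k) → γ) (z : γ),
      (fun i => (Fin.snoc w z : Fin (4 + k + 1) → γ)
        ((Fin.snoc (fun i => (Fin.natAdd 4 i).castSucc) (Fin.last (4 + k)) :
          Fin (k + 1) → Fin (4 + k + 1)) i)) =
        Fin.snoc (fun i => w (Fin.natAdd 4 i)) z := by
    intro γ w z
    funext i
    refine Fin.lastCases ?_ (fun i => ?_) i <;> simp only [Fin.snoc_last, Fin.snoc_castSucc]
  have hrel₁ := isDelta0_rel k (Fin.castAdd k (1 : Fin 4)) (Fin.natAdd 4)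
  have hrel₂ := isDelta0_rel k (Fin.castAdd k (1 : Fin 4)).castSucc
    (fun i => (Fin.natAdd 4 i).castSucc)
  have hrel₃ := isDelta0_rel (k + 1) (Fin.castAdd k (2 : Fin 4)).castSucc
    (Fin.snoc (fun i => (Fin.natAdd 4 i).castSucc) (Fin.last (4 + k)))
  have hmem : ∀ {γ : Type u} {F : γ → γ → Prop} {c d e : γ} {x : Fin k → γ} {z : γ},
      (∀ w, F w c → F w e) → (∀ w, F w d → F w e) → (∀ i, F (x i) c) → F z d →
      ∀ i, F ((Fin.snoc x z : Fin (k + 1) → γ) i) e := by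
    intro γ F c d e x z hc hd hx hz
    refine Fin.lastCases ?_ fun i => ?_
    · simpa using hd z hz
    · simpa using hc _ (hx i)
  constructor
  · intro hy'
    obtain ⟨b, hb⟩ := exists_bound hpair hsep hcoll hprod φ a
    obtain ⟨d, had, hbd⟩ := exists_superset_union hpair hunion a b
    obtain ⟨t, ht⟩ := exists_code hpair hsep hprod φ d
    have h := hj.forall_tuple 0 (hrel₁.imp (.bex (Fin.castAdd k 3) hrel₃)) ![a, s, t, b]
    simp only [Sat, sat_imp, sat_rel, Fin.append_left, Fin.append_right, hsnoc,
      Fin.snoc_castSucc, Matrix.cons_val_zero, Matrix.cons_val_one, Matrix.cons_val] at h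
    obtain ⟨z, hz, hyz⟩ := h (fun x hx hxs => by
      obtain ⟨z, hz, hxz⟩ := hb x hx ((hs x hx).1 hxs)
      exact ⟨z, hz, (ht _ (hmem had hbd hx hz)).2 hxz⟩) y hy hy'
    exact ⟨z, (hφ d t ht _ (hmem (hj.subset had) (hj.subset hbd) hy hz)).1 hyz⟩
  · rintro ⟨z, hyz⟩
    obtain ⟨c, hz⟩ := hcof z
    obtain ⟨d, had, hcd⟩ := exists_superset_union hpair hunion a c
    obtain ⟨t, ht⟩ := exists_code hpair hsep hprod φ d
    have h := hj.forall_tuple 0 (.ball (Fin.castAdd k 3) (hrel₃.imp hrel₂)) ![a, s, t, c]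
    simp only [Sat, sat_imp, sat_rel, Fin.append_left, Fin.append_right, hsnoc,
      Fin.snoc_castSucc, Matrix.cons_val_zero, Matrix.cons_val_one, Matrix.cons_val] at h
    exact h (fun x hx z hz hxz => (hs x hx).2 ⟨z, (ht _ (hmem had hcd hx hz)).1 hxz⟩) y hy z hz
      ((hφ d t ht _ (hmem (hj.subset had) (hj.subset hcd) hy hz)).2 hyz)

theorem preservesCodes (hj : Delta0Elementary E E' j) (hpair : APair E) (hunion : AUnion E)
    (hsep : ASep E) (hcoll : ACollA E) (hprod : AProd E) (hcof : ∀ y : β, ∃ a : α, E' y (j a))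
    {k : ℕ} (φ : Fml k) : PreservesCodes E E' j φ := by
  have hnot : ∀ {k : ℕ} {φ : Fml k}, PreservesCodes E E' j φ → PreservesCodes E E' j φ.not :=
    hj.preservesCodes_not hpair hsep hprod
  have hand : ∀ {k : ℕ} {φ ψ : Fml k}, PreservesCodes E E' j φ → PreservesCodes E E' j ψ →
      PreservesCodes E E' j (φ.and ψ) := hj.preservesCodes_and hpair hsep hprod
  have hex : ∀ {k : ℕ} {φ : Fml (k + 1)}, PreservesCodes E E' j φ → PreservesCodes E E' j φ.ex :=
    hj.preservesCodes_ex hpair hunion hsep hcoll hprod hcof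
  have hmem : ∀ {k : ℕ} (m n : Fin k), PreservesCodes E E' j (.mem m n) :=
    fun m n => hj.preservesCodes_of_isDelta0 (.mem m n)
  induction φ with
  | mem m n => exact hmem m n
  | eq m n => exact hj.preservesCodes_of_isDelta0 (.eq m n)
  | not φ ih => exact hnot ih
  | and φ ψ ih₁ ih₂ => exact hand ih₁ ih₂
  | ball i φ ih =>
    exact (hnot (hex (hand (hmem (Fin.last _) i.castSucc) (hnot ih)))).congr
      (by simp [Sat]) (by simp [Sat])
  | bex i φ ih =>
    exact (hex (hand (hmem (Fin.last _) i.castSucc) ih)).congr (by simp [Sat]) (by simp [Sat])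
  | all φ ih => exact (hnot (hex (hnot ih))).congr (by simp [Sat]) (by simp [Sat])
  | ex φ ih => exact hex ih

end Delta0Elementary

end Elementarity

/-- Gaifman's theorem. If M satisfies collection, pairing, union,
infinity, separation and the existence of cartesian products, and j : M → N is a
Δ₀-elementary cofinal embedding of ∈-structures, then j is fully elementary. -/
theorem gaifman {α β : Type u} (E : α → α → Prop) (E' : β → β → Prop)
    (hpair : APair E) (hunion : AUnion E) (hinf : AInf E) (hsep : ASep E)
    (hcoll : ACollA E) (hprod : AProd E)
    (j : α → β)
    (hcof : ∀ y : β, ∃ a : α, E' y (j a))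
    (hd0 : ∀ {n : ℕ} (φ : Fml n), IsDelta0 φ → ∀ v : Fin n → α,
      (Sat E φ v ↔ Sat E' φ (fun i => j (v i)))) :
    ∀ {n : ℕ} (φ : Fml n) (v : Fin n → α),
      Sat E φ v ↔ Sat E' φ (fun i => j (v i)) := by
  intro n φ v
  have : Nonempty α := hinf.nonempty
  have hj : Delta0Elementary E E' j := hd0
  obtain ⟨a, ha⟩ := exists_forall_mem hpair hunion v
  obtain ⟨s, hs⟩ := exists_code hpair hsep hprod φ a
  rw [← hs v ha, hj.tupleMem_iff]
  exact hj.preservesCodes hpair hunion hsep hcoll hprod hcof φ a s hs _ fun i => hj.mem (ha i)
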